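/- arXiv:2104.04012 — 4 statements merged into one kernel-verified Lean document; each statement's English description precedes it below -/
import Mathlib

section
/- (With gradient structure, non-zero eigenvalues are bifurcation points.) Let X be a real Hilbert space, L : X → X a compact self-adjoint linear operator, and R : X → X continuous and compact with ‖R(x)‖/‖x‖ → 0 as 0 ≠ ‖x‖ → 0. Suppose R = ∇r is the gradient of a weakly continuous function r : X → ℝ, and that the Fréchet derivative x ↦ dR[x] of R exists and is bounded and uniformly continuous in a neighbourhood of 0 in X. Then every eigenvalue λ₀ ≠ 0 of L is a bifurcation point of the equation λx = Lx + R(x). -/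
open Filter
open scoped RealInnerProductSpace

/-- A compact self-adjoint operator shifted by a non-zero scalar has a bounded pseudo-inverse with
values orthogonal to the kernel. -/
theorem IsCompactOperator.exists_pseudoinverse_sub_smul {X : Type*} [NormedAddCommGroup X]
    [InnerProductSpace ℝ X] [CompleteSpace X] {L : X →L[ℝ] X} (hLc : IsCompactOperator L)
    (hLsa : ∀ x y : X, ⟪L x, y⟫ = ⟪x, L y⟫) {μ : ℝ} (hμ : μ ≠ 0) :
    ∃ S : X →L[ℝ] X,
      (∀ y, ∀ n ∈ Module.End.eigenspace L.toLinearMap μ, ⟪S y, n⟫ = 0) ∧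
      ∀ y, y - (L (S y) - μ • S y) ∈ Module.End.eigenspace L.toLinearMap μ := by
  set N := Module.End.eigenspace L.toLinearMap μ with hN
  have : FiniteDimensional ℝ N := ContinuousLinearMap.finite_dimensional_eigenspace hLc μ hμ
  have hmem : ∀ x, x ∈ N ↔ L x = μ • x := fun x => by
    rw [hN, Module.End.mem_eigenspace_iff]; rfl
  let P : X →L[ℝ] X := N.starProjection
  have hPmem : ∀ x, P x ∈ N := fun x => N.starProjection_apply_mem x
  have hTorth : ∀ x, ∀ n ∈ N, ⟪L x - μ • x, n⟫ = 0 := fun x n hn => by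
    rw [inner_sub_left, hLsa, (hmem n).1 hn, real_inner_smul_left, real_inner_smul_right, sub_self]
  have hPc : IsCompactOperator P :=
    (isCompactOperator_of_locallyCompactSpace_rng (M₃ := X) N.subtypeL).comp_clm
      N.orthogonalProjectionOnto
  have hres : μ ∈ resolventSet ℝ (L + P) := by
    refine ((hLc.add hPc).hasEigenvalue_or_mem_resolventSet (T := L + P) hμ).resolve_left ?_
    intro h
    obtain ⟨x, hx⟩ := h.exists_hasEigenvector
    have h1 : L x + P x = μ • x := hx.apply_eq_smul
    have h2 : P x = 0 := by
      have h3 := hTorth x (P x) (hPmem x)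
      rw [← h1, sub_add_cancel_left, inner_neg_left, neg_eq_zero, inner_self_eq_zero] at h3
      exact h3
    have hxN : x ∈ N := (hmem x).2 (by rwa [h2, add_zero] at h1)
    exact hx.2 (by rw [← h2]; exact (N.starProjection_eq_self_iff.2 hxN).symm)
  obtain ⟨E, hE⟩ := (spectrum.mem_resolventSet_iff.1 hres).exists_right_inv
  have hE' : ∀ y, L (E y) + P (E y) - μ • E y = - y := fun y => by
    have := congrArg (fun A : X →L[ℝ] X => A y) hE
    simp only [Algebra.algebraMap_eq_smul_one, mul_apply_eq_comp, sub_apply, add_apply,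
      smul_apply, one_apply_eq_self] at this
    linear_combination (norm := module) -this
  let S : X →L[ℝ] X := - (E ∘L (ContinuousLinearMap.id ℝ X - P))
  have hS : ∀ y, L (S y) - μ • S y + P (S y) = y - P y := fun y => by
    have := hE' (y - P y)
    rw [← neg_inj, ← this]
    simp only [S, neg_apply, ContinuousLinearMap.comp_apply,
      sub_apply, ContinuousLinearMap.id_apply, map_neg, smul_neg]
    abel
  have hPS : ∀ y, P (S y) = 0 := fun y => by
    rw [← inner_self_eq_zero (𝕜 := ℝ)]
    have h1 : ⟪y - P y, P (S y)⟫ = 0 := N.starProjection_inner_eq_zero _ _ (hPmem _)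
    rwa [← hS y, inner_add_left, hTorth _ _ (hPmem _), zero_add] at h1
  refine ⟨S, fun y n hn => ?_, fun y => ?_⟩
  · have h1 := N.starProjection_inner_eq_zero (S y) n hn
    change ⟪S y - P (S y), n⟫ = 0 at h1
    rwa [hPS, sub_zero] at h1
  · have h1 := hS y
    rw [hPS, add_zero] at h1
    rw [h1, sub_sub_cancel]
    exact hPmem y

/-- A map whose derivative is continuous and vanishes at the origin has arbitrarily small Lipschitz
constants on small balls. -/
theorem exists_closedBall_lipschitz_of_fderiv_zero {X : Type*} [NormedAddCommGroup X]
    [InnerProductSpace ℝ X] {R : X → X}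
    (hR : HasFDerivAt R (0 : X →L[ℝ] X) 0) {D : X → X →L[ℝ] X}
    (hD : ∀ᶠ x in nhds 0, HasFDerivAt R (D x) x) (hDc : ContinuousAt D 0) {η : ℝ} (hη : 0 < η) :
    ∃ δ > 0, ∀ x y : X, ‖x‖ ≤ δ → ‖y‖ ≤ δ → ‖R x - R y‖ ≤ η * ‖x - y‖ := by
  have hD0 : D 0 = 0 := hD.self_of_nhds.unique hR
  have hsm : ∀ᶠ x in nhds (0 : X), ‖D x‖ ≤ η := by
    filter_upwards [hDc.norm.eventually_le_const (u := η) (by simpa [hD0] using hη)] with x hx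
    exact hx
  obtain ⟨δ, hδ, hball⟩ := Metric.nhds_basis_closedBall.mem_iff.1 (hD.and hsm)
  refine ⟨δ, hδ, fun x y hx hy => ?_⟩
  exact (convex_closedBall (0 : X) δ).norm_image_sub_le_of_norm_hasFDerivWithin_le
    (fun z hz => (hball hz).1.hasFDerivWithinAt) (fun z hz => (hball hz).2)
    (by simpa using hy) (by simpa using hx)

theorem norm_sq_smul_sub_le {X : Type*} [NormedAddCommGroup X] [NormedSpace ℝ X] {M : ℝ}
    {x y : X} (hx : ‖x‖ ≤ M) (hy : ‖y‖ ≤ M) :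
    ‖‖x‖ ^ 2 • x - ‖y‖ ^ 2 • y‖ ≤ 3 * M ^ 2 * ‖x - y‖ := by
  have h : ‖x‖ ^ 2 • x - ‖y‖ ^ 2 • y = ‖x‖ ^ 2 • (x - y) + (‖x‖ ^ 2 - ‖y‖ ^ 2) • y := by module
  have h1 : |‖x‖ ^ 2 - ‖y‖ ^ 2| ≤ ‖x - y‖ * (2 * M) := by
    rw [sq_sub_sq, mul_comm, abs_mul]
    gcongr
    · exact abs_norm_sub_norm_le x y
    · rw [abs_of_nonneg (by positivity)]; linarith
  have hM : 0 ≤ M := (norm_nonneg x).trans hx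
  calc _ ≤ ‖x‖ ^ 2 * ‖x - y‖ + |‖x‖ ^ 2 - ‖y‖ ^ 2| * ‖y‖ := by
        rw [h]; refine (norm_add_le _ _).trans (le_of_eq ?_)
        rw [norm_smul, norm_smul, Real.norm_eq_abs, Real.norm_eq_abs, abs_of_nonneg (sq_nonneg ‖x‖)]
    _ ≤ M ^ 2 * ‖x - y‖ + ‖x - y‖ * (2 * M) * M := by gcongr
    _ = _ := by ring

/-- Variational Lyapunov–Schmidt reduction: if `F` is a contraction with values orthogonal to the
finite-dimensional space `N`, and the gradient of `K` lies in `N` along `{x | x + F x ∈ N}`, then an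
interior maximum of `K` on this set is a critical point of `K`. -/
theorem exists_critical_of_reduction {X : Type*} [NormedAddCommGroup X] [InnerProductSpace ℝ X]
    [CompleteSpace X] {N : Submodule ℝ X} [FiniteDimensional ℝ N] {F : X → X} {a : ℝ} (ha : 0 ≤ a)
    (hF0 : F 0 = 0)
    (hF : ∀ x y : X, ‖x‖ ≤ 2 * a → ‖y‖ ≤ 2 * a → ‖F x - F y‖ ≤ 1 / 2 * ‖x - y‖)
    (hFN : ∀ x, ∀ n ∈ N, ⟪F x, n⟫ = 0) {K : X → ℝ} {G : X → X}
    (hK : ∀ x, HasGradientAt K (G x) x) (hG : ∀ x, x + F x ∈ N → G x ∈ N) {m : ℝ}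
    (hbdry : ∀ x, ‖x‖ ≤ 2 * a → x + F x ∈ N → ‖x + F x‖ = a → K x < m)
    {v₁ : X} (hv₁ : v₁ ∈ N) (hv₁a : ‖v₁‖ ≤ a)
    (hm : ∀ x, ‖x‖ ≤ 2 * a → x + F x = v₁ → m ≤ K x) :
    ∃ x, ‖x‖ ≤ 2 * a ∧ G x = 0 ∧ m ≤ K x := by
  have happ : ApproximatesLinearOn (fun x => x + F x)
      ((ContinuousLinearEquiv.refl ℝ X : X ≃L[ℝ] X) : X →L[ℝ] X)
      (Metric.closedBall 0 (2 * a)) (1 / 2) := by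
    intro x hx y hy
    have := hF x y (by simpa using hx) (by simpa using hy)
    simpa [add_sub_add_comm] using this
  have hsurj : ∀ v : X, ‖v‖ ≤ a → ∃ x, ‖x‖ ≤ 2 * a ∧ x + F x = v := fun v hv => by
    let inv : ((ContinuousLinearEquiv.refl ℝ X : X ≃L[ℝ] X) : X →L[ℝ] X).NonlinearRightInverse :=
      ⟨id, 1, fun y => by simp, fun y => by simp⟩
    obtain ⟨x, hx, hxv⟩ := happ.surjOn_closedBall_of_nonlinearRightInverse inv
      (b := 0) (by positivity : 0 ≤ 2 * a) subset_rfl (a := v) (by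
        simp only [inv, hF0, mem_closedBall_zero_iff, add_zero]
        norm_num
        linarith)
    exact ⟨x, by simpa using hx, hxv⟩
  have hanti : ∀ x y : X, ‖x‖ ≤ 2 * a → ‖y‖ ≤ 2 * a →
      ‖x - y‖ ≤ 2 * ‖(x + F x) - (y + F y)‖ := fun x y hx hy => by
    have h1 := hF x y hx hy
    have h2 : x - y = ((x + F x) - (y + F y)) - (F x - F y) := by abel
    have h3 := norm_sub_le ((x + F x) - (y + F y)) (F x - F y)
    rw [← h2] at h3
    linarith
  choose! ξ hξ hξv using hsurj
  have hξc : ContinuousOn (fun v : N => K (ξ v)) (Metric.closedBall 0 a) := by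
    have h1 : LipschitzOnWith 2 (fun v : N => ξ v) (Metric.closedBall 0 a) :=
      LipschitzOnWith.of_dist_le_mul fun v hv w hw => by
        have hv' : ‖(v : X)‖ ≤ a := by simpa using hv
        have hw' : ‖(w : X)‖ ≤ a := by simpa using hw
        have := hanti _ _ (hξ v hv') (hξ w hw')
        rw [hξv _ hv', hξv _ hw'] at this
        simpa [dist_eq_norm, Subtype.dist_eq] using this
    have hKc : Continuous K :=
      continuous_iff_continuousAt.2 fun x => (hK x).differentiableAt.continuousAt
    exact hKc.comp_continuousOn h1.continuousOn
  obtain ⟨v, hv, hmax⟩ := (isCompact_closedBall (0 : N) a).exists_isMaxOn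
    ⟨0, by simpa using ha⟩ hξc
  have hva : ‖(v : X)‖ ≤ a := by simpa using hv
  have hmv : m ≤ K (ξ v) :=
    (hm _ (hξ v₁ hv₁a) (hξv v₁ hv₁a)).trans (hmax (a := ⟨v₁, hv₁⟩) (by simpa using hv₁a))
  have hvN : ξ v + F (ξ v) ∈ N := by rw [hξv _ hva]; exact v.2
  have hvlt : ‖(v : X)‖ < a := hva.lt_of_ne fun h =>
    (hbdry _ (hξ v hva) hvN (by rw [hξv _ hva, h])).not_ge hmv
  refine ⟨ξ v, hξ v hva, ?_, hmv⟩
  by_contra hz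
  have hzN := hG _ hvN
  set z := G (ξ v) with hzdef
  have hz0 : 0 < ‖z‖ := norm_pos_iff.2 hz
  let u : ℝ → X := fun t => v + t • z
  have hut : Tendsto (fun t => ‖u t‖) (nhdsWithin 0 (Set.Ioi 0)) (nhds ‖(v : X)‖) := by
    have : Continuous fun t => ‖u t‖ := by fun_prop
    simpa [u] using (this.tendsto 0).mono_left nhdsWithin_le_nhds
  have hua : ∀ᶠ t in nhdsWithin (0 : ℝ) (Set.Ioi 0), ‖u t‖ ≤ a := hut.eventually_le_const hvlt
  have hdist : ∀ t, ‖u t‖ ≤ a → ‖ξ (u t) - ξ v‖ ≤ 2 * (|t| * ‖z‖) := fun t ht => by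
    have := hanti _ _ (hξ _ ht) (hξ v hva)
    rw [hξv _ ht, hξv _ hva] at this
    simpa [u, norm_smul] using this
  have hξt : Tendsto (fun t => ξ (u t)) (nhdsWithin 0 (Set.Ioi 0)) (nhds (ξ v)) := by
    rw [tendsto_iff_norm_sub_tendsto_zero]
    refine squeeze_zero' (.of_forall fun _ => norm_nonneg _)
      (hua.mono fun t ht => hdist t ht) ?_
    have : Continuous fun t : ℝ => 2 * (|t| * ‖z‖) := by fun_prop
    simpa using (this.tendsto 0).mono_left nhdsWithin_le_nhds
  have hlo := hξt.eventually
    ((hasFDerivAt_iff_isLittleO.1 (hK (ξ v)).hasFDerivAt).def (c := ‖z‖ / 4) (by positivity))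
  obtain ⟨t, ⟨htlo, hta⟩, ht0⟩ := ((hlo.and hua).and self_mem_nhdsWithin).exists
  have ht : 0 < t := ht0
  have hle : K (ξ (u t)) ≤ K (ξ v) :=
    hmax (a := ⟨u t, N.add_mem v.2 (N.smul_mem t hzN)⟩) (by simpa using hta)
  have hinner : ⟪z, ξ (u t) - ξ v⟫ = t * ‖z‖ ^ 2 := by
    have h1 : ξ (u t) - ξ v = t • z - F (ξ (u t)) + F (ξ v) := by
      have e1 := hξv _ hta
      have e2 := hξv _ hva
      have e3 : u t = v + t • z := rfl
      linear_combination (norm := module) e1 - e2 + e3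
    rw [h1, inner_add_right, inner_sub_right, real_inner_comm (F _) z, real_inner_comm (F _) z,
      hFN _ z hzN, hFN _ z hzN, real_inner_smul_right, real_inner_self_eq_norm_sq, sub_zero,
      add_zero]
  have hd := hdist t hta
  rw [abs_of_pos ht] at hd
  simp only [InnerProductSpace.toDual_apply_apply, ← hzdef, hinner, Real.norm_eq_abs] at htlo
  have h5 := (abs_le.1 htlo).1
  nlinarith [mul_pos ht (pow_pos hz0 2), mul_le_mul_of_nonneg_left hd hz0.le]

/-- The gradient of the functional whose critical points solve
`(μ - ε * (1 - ‖x‖ ^ 2 / ρ ^ 2)) • x = L x + R x`. -/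
theorem hasGradientAt_penalized {X : Type*} [NormedAddCommGroup X] [InnerProductSpace ℝ X]
    [CompleteSpace X] {L : X →L[ℝ] X} (hLsa : ∀ x y : X, ⟪L x, y⟫ = ⟪x, L y⟫) {R : X → X}
    {r : X → ℝ} (hgrad : ∀ x : X, HasGradientAt r (R x) x) (μ ε ρ : ℝ) (x : X) :
    HasGradientAt (fun x => ⟪L x - μ • x, x⟫ / 2 + (r x - r 0) +
        ε * (‖x‖ ^ 2 / 2 - (‖x‖ ^ 2) ^ 2 / (4 * ρ ^ 2)))
      ((L x - μ • x) + (R x + (ε * (1 - ‖x‖ ^ 2 / ρ ^ 2)) • x)) x := by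
  rw [hasGradientAt_iff_hasFDerivAt]
  have h1 : HasFDerivAt (fun x => L x - μ • x) (L - μ • ContinuousLinearMap.id ℝ X) x :=
    (L - μ • ContinuousLinearMap.id ℝ X).hasFDerivAt
  have h2 := (h1.inner ℝ (hasFDerivAt_id x)).mul_const (1 / 2)
  have h3 := (hgrad x).hasFDerivAt.sub_const (r 0)
  have h4 := (hasFDerivAt_id x).norm_sq
  have h5 := ((h4.mul_const (1 / 2)).sub ((h4.pow 2).mul_const (1 / (4 * ρ ^ 2)))).const_mul ε
  refine (((h2.add h3).add h5).congr_fderiv ?_).congr_of_eventuallyEq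
    (.of_forall fun y => by simp; ring)
  ext y
  have h6 : ⟪L y, x⟫ = ⟪L x, y⟫ := by rw [hLsa, real_inner_comm]
  have h7 : ⟪y, x⟫ = ⟪x, y⟫ := real_inner_comm _ _
  simp [inner_sub_left, inner_smul_left, h6, h7]
  ring

/-- Close to a non-zero eigenvalue of `L` there are small non-trivial solutions. -/
theorem exists_small_solution {X : Type*} [NormedAddCommGroup X] [InnerProductSpace ℝ X]
    [CompleteSpace X] {L : X →L[ℝ] X} (hLc : IsCompactOperator L)
    (hLsa : ∀ x y : X, ⟪L x, y⟫ = ⟪x, L y⟫) {R : X → X} (hR0 : R 0 = 0)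
    (hRlip : ∀ η > 0, ∃ δ > 0, ∀ x y : X, ‖x‖ ≤ δ → ‖y‖ ≤ δ → ‖R x - R y‖ ≤ η * ‖x - y‖)
    {r : X → ℝ} (hgrad : ∀ x : X, HasGradientAt r (R x) x) {μ : ℝ} (hμ : μ ≠ 0)
    (heig : ∃ x : X, x ≠ 0 ∧ L x = μ • x) {δ : ℝ} (hδ : 0 < δ) :
    ∃ (lam : ℝ) (x : X), x ≠ 0 ∧ lam • x = L x + R x ∧ |lam - μ| ≤ δ ∧ ‖x‖ ≤ δ := by
  obtain ⟨S, hSN, hTS⟩ := hLc.exists_pseudoinverse_sub_smul hLsa hμ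
  set N := Module.End.eigenspace L.toLinearMap μ with hN
  have : FiniteDimensional ℝ N := ContinuousLinearMap.finite_dimensional_eigenspace hLc μ hμ
  have hmem : ∀ x, x ∈ N ↔ L x = μ • x := fun x => by
    rw [hN, Module.End.mem_eigenspace_iff]; rfl
  set T : X →L[ℝ] X := L - μ • ContinuousLinearMap.id ℝ X with hT
  have hTapp : ∀ x, T x = L x - μ • x := fun x => rfl
  have hTN : ∀ n ∈ N, T n = 0 := fun n hn => by rw [hTapp, (hmem n).1 hn, sub_self]
  have hTsa : ∀ x y, ⟪T x, y⟫ = ⟪x, T y⟫ := fun x y => by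
    simp only [hTapp, inner_sub_left, inner_sub_right, hLsa, real_inner_smul_left,
      real_inner_smul_right]
  obtain ⟨ε, hε, hεδ, hεS, hεT⟩ : ∃ ε > 0, 17 * ε ≤ δ ∧ 400 * ‖S‖ * ε ≤ 1 ∧
      2000000 * ‖T‖ * ‖S‖ ^ 2 * ε ≤ 1 := by
    set c := 17 / δ + 400 * ‖S‖ + 2000000 * ‖T‖ * ‖S‖ ^ 2 with hc
    have h1 : 0 < 17 / δ := by positivity
    have h2 : 0 ≤ 400 * ‖S‖ := by positivity
    have h3 : 0 ≤ 2000000 * ‖T‖ * ‖S‖ ^ 2 := by positivity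
    have hc0 : 0 < c := by positivity
    refine ⟨1 / c, by positivity, ?_, ?_, ?_⟩
    · rw [mul_one_div, div_le_iff₀ hc0]
      calc (17 : ℝ) = δ * (17 / δ) := by field_simp
        _ ≤ δ * c := by gcongr; linarith
    · rw [mul_one_div, div_le_one₀ hc0]; linarith
    · rw [mul_one_div, div_le_one₀ hc0]; linarith
  obtain ⟨δ', hδ', hlip⟩ := hRlip (ε / 1000) (by positivity)
  obtain ⟨ρ, hρ, hρδ, hρδ'⟩ : ∃ ρ > 0, 4 * ρ ≤ δ ∧ 4 * ρ ≤ δ' :=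
    ⟨min δ δ' / 4, by positivity, by linarith [min_le_left δ δ'], by linarith [min_le_right δ δ']⟩
  let B : X → X := fun x => R x + (ε * (1 - ‖x‖ ^ 2 / ρ ^ 2)) • x
  have hB0 : B 0 = 0 := by simp [B, hR0]
  have hBlip : ∀ x y : X, ‖x‖ ≤ 4 * ρ → ‖y‖ ≤ 4 * ρ → ‖B x - B y‖ ≤ 50 * ε * ‖x - y‖ := by
    intro x y hx hy
    have h1 := hlip x y (hx.trans hρδ') (hy.trans hρδ')
    have h2 := norm_sq_smul_sub_le hx hy
    have h3 : B x - B y = (R x - R y) + ε • (x - y) -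
        (ε / ρ ^ 2) • (‖x‖ ^ 2 • x - ‖y‖ ^ 2 • y) := by
      simp only [B]; module
    have h4 : ε / ρ ^ 2 * (3 * (4 * ρ) ^ 2 * ‖x - y‖) = 48 * ε * ‖x - y‖ := by
      field_simp; ring
    calc ‖B x - B y‖ ≤ ‖R x - R y‖ + ‖ε • (x - y)‖ +
          ‖(ε / ρ ^ 2) • (‖x‖ ^ 2 • x - ‖y‖ ^ 2 • y)‖ := by
          rw [h3]; exact (norm_sub_le _ _).trans (by gcongr; exact norm_add_le _ _)
      _ = ‖R x - R y‖ + ε * ‖x - y‖ + ε / ρ ^ 2 * ‖‖x‖ ^ 2 • x - ‖y‖ ^ 2 • y‖ := by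
          rw [norm_smul, norm_smul, Real.norm_of_nonneg hε.le,
            Real.norm_of_nonneg (by positivity : 0 ≤ ε / ρ ^ 2)]
      _ ≤ ε / 1000 * ‖x - y‖ + ε * ‖x - y‖ + ε / ρ ^ 2 * (3 * (4 * ρ) ^ 2 * ‖x - y‖) := by gcongr
      _ ≤ 50 * ε * ‖x - y‖ := by
          rw [h4]; nlinarith [mul_nonneg hε.le (norm_nonneg (x - y))]
  have hFlip : ∀ x y : X, ‖x‖ ≤ 4 * ρ → ‖y‖ ≤ 4 * ρ →
      ‖S (B x) - S (B y)‖ ≤ 50 * ‖S‖ * ε * ‖x - y‖ := fun x y hx hy => by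
    rw [← map_sub]
    calc _ ≤ ‖S‖ * (50 * ε * ‖x - y‖) := S.le_opNorm_of_le (hBlip x y hx hy)
      _ = _ := by ring
  let K : X → ℝ := fun x => ⟪L x - μ • x, x⟫ / 2 + (r x - r 0) +
    ε * (‖x‖ ^ 2 / 2 - (‖x‖ ^ 2) ^ 2 / (4 * ρ ^ 2))
  have hr : ∀ x, ‖x‖ ≤ 4 * ρ → |r x - r 0| ≤ ε / 1000 * (4 * ρ) * (4 * ρ) := fun x hx => by
    have h1 : ‖r x - r 0‖ ≤ ε / 1000 * (4 * ρ) * ‖x - 0‖ :=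
      (convex_closedBall (0 : X) (4 * ρ)).norm_image_sub_le_of_norm_hasFDerivWithin_le
        (fun z _ => (hgrad z).hasFDerivAt.hasFDerivWithinAt) (fun z hz => by
          have hz' : ‖z‖ ≤ 4 * ρ := by simpa using hz
          have h2 := hlip z 0 (hz'.trans hρδ') (by simpa using hδ'.le)
          rw [hR0, sub_zero, sub_zero] at h2
          rw [LinearIsometryEquiv.norm_map]
          exact h2.trans (by gcongr))
        (by simp; positivity) (by simpa using hx)
    rw [sub_zero] at h1
    exact h1.trans (by gcongr)
  have hest : ∀ x, ‖x‖ ≤ 4 * ρ → x + S (B x) ∈ N →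
      |K x - ε * (‖x‖ ^ 2 / 2 - (‖x‖ ^ 2) ^ 2 / (4 * ρ ^ 2))| ≤ ε * ρ ^ 2 * (3 / 100) ∧
      ‖x + S (B x)‖ ^ 2 ≤ ‖x‖ ^ 2 ∧ ‖x‖ ^ 2 ≤ ‖x + S (B x)‖ ^ 2 + ρ ^ 2 / 4 := by
    intro x hx hv
    have hw : ‖S (B x)‖ ≤ 200 * ‖S‖ * ε * ρ := by
      have h1 := hFlip x 0 hx (by simpa using hρ.le)
      rw [hB0, map_zero, sub_zero, sub_zero] at h1
      calc _ ≤ 50 * ‖S‖ * ε * ‖x‖ := h1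
        _ ≤ 50 * ‖S‖ * ε * (4 * ρ) := by gcongr
        _ = _ := by ring
    have hw2 : ‖S (B x)‖ ^ 2 ≤ ρ ^ 2 / 4 := by
      have h1 : ‖S (B x)‖ ≤ ρ / 2 := by nlinarith
      calc _ ≤ (ρ / 2) ^ 2 := by gcongr
        _ = _ := by ring
    have horth := hSN (B x) _ hv
    set w := S (B x)
    set v := x + w
    have hxvw : x = v - w := (add_sub_cancel_right x w).symm
    have hpyth : ‖x‖ ^ 2 = ‖v‖ ^ 2 + ‖w‖ ^ 2 := by
      rw [hxvw, norm_sub_sq_real, real_inner_comm, horth]; ring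
    have hquad : ⟪T x, x⟫ = ⟪T w, w⟫ := by
      rw [hxvw, map_sub, hTN v hv, zero_sub, inner_neg_left, inner_sub_right, hTsa w v, hTN v hv,
        inner_zero_right, zero_sub, neg_neg]
    have hTw : |⟪T w, w⟫| ≤ ε * ρ ^ 2 / 50 := by
      calc _ ≤ ‖T w‖ * ‖w‖ := abs_real_inner_le_norm _ _
        _ ≤ ‖T‖ * ‖w‖ * ‖w‖ := by gcongr; exact T.le_opNorm w
        _ ≤ ‖T‖ * (200 * ‖S‖ * ε * ρ) * (200 * ‖S‖ * ε * ρ) := by gcongr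
        _ = (2000000 * ‖T‖ * ‖S‖ ^ 2 * ε) * (ε * ρ ^ 2 / 50) := by ring
        _ ≤ 1 * (ε * ρ ^ 2 / 50) := by gcongr
        _ = _ := one_mul _
    refine ⟨?_, by rw [hpyth]; linarith [sq_nonneg ‖w‖], by linarith⟩
    have hr' := abs_le.1 (hr x hx)
    have hT' := abs_le.1 hTw
    have hερ : 0 < ε * ρ ^ 2 := by positivity
    have hKx : K x - ε * (‖x‖ ^ 2 / 2 - (‖x‖ ^ 2) ^ 2 / (4 * ρ ^ 2)) =
        ⟪T w, w⟫ / 2 + (r x - r 0) := by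
      rw [← hquad, hTapp]; simp only [K]; ring
    rw [hKx, abs_le]
    constructor <;> nlinarith
  have hfactor : ∀ q : ℝ, ε * (q / 2 - q ^ 2 / (4 * ρ ^ 2)) =
      ε * (q * (2 * ρ ^ 2 - q) / (4 * ρ ^ 2)) := fun q => by field_simp; ring
  have hρ2 : 0 < ρ ^ 2 := by positivity
  have hερ : 0 < ε * ρ ^ 2 := by positivity
  obtain ⟨v₀, hv₀, hLv₀⟩ := heig
  have hv₀n : 0 < ‖v₀‖ := norm_pos_iff.2 hv₀
  have hnorm : ‖(ρ / ‖v₀‖) • v₀‖ = ρ := by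
    rw [norm_smul, Real.norm_of_nonneg (by positivity), div_mul_cancel₀ _ hv₀n.ne']
  obtain ⟨x, hx, hGx, hKx⟩ := exists_critical_of_reduction (N := N) (F := fun x => S (B x))
    (a := 2 * ρ) (by positivity) (by simp [hB0])
    (fun x y hx hy => (hFlip x y (by linarith) (by linarith)).trans (by gcongr; linarith))
    (fun x n hn => hSN _ n hn) (K := K) (G := fun x => (L x - μ • x) + B x)
    (hasGradientAt_penalized hLsa hgrad μ ε ρ)
    (fun x hx => by
      have h1 : L x - μ • x = - (L (S (B x)) - μ • S (B x)) := by
        have := hTN _ hx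
        rw [map_add] at this
        exact eq_neg_of_add_eq_zero_left this
      rw [h1, neg_add_eq_sub]
      exact hTS (B x))
    (m := ε * ρ ^ 2 / 16)
    (fun x hx hv hva => by
      obtain ⟨h1, h2, -⟩ := hest x (by linarith) hv
      rw [hva] at h2
      have h3 : ‖x‖ ^ 2 * (2 * ρ ^ 2 - ‖x‖ ^ 2) / (4 * ρ ^ 2) ≤ -2 * ρ ^ 2 := by
        rw [div_le_iff₀ (by positivity)]; nlinarith
      have h4 := mul_le_mul_of_nonneg_left h3 hε.le
      rw [← hfactor] at h4
      linarith [(abs_le.1 h1).2])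
    (v₁ := (ρ / ‖v₀‖) • v₀) (N.smul_mem _ ((hmem v₀).2 hLv₀)) (by rw [hnorm]; linarith)
    (fun x hx hxv => by
      have hv : x + S (B x) ∈ N := hxv ▸ N.smul_mem _ ((hmem v₀).2 hLv₀)
      obtain ⟨h1, h2, h3⟩ := hest x (by linarith) hv
      rw [hxv, hnorm] at h2 h3
      have h4 : 3 / 16 * ρ ^ 2 ≤ ‖x‖ ^ 2 * (2 * ρ ^ 2 - ‖x‖ ^ 2) / (4 * ρ ^ 2) := by
        rw [le_div_iff₀ (by positivity)]; nlinarith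
      have h5 := mul_le_mul_of_nonneg_left h4 hε.le
      rw [← hfactor] at h5
      linarith [(abs_le.1 h1).1])
  replace hx : ‖x‖ ≤ 4 * ρ := by linarith
  refine ⟨μ - ε * (1 - ‖x‖ ^ 2 / ρ ^ 2), x, ?_, ?_, ?_, hx.trans hρδ⟩
  · rintro rfl
    have : K 0 = 0 := by simp [K]
    linarith
  · linear_combination (norm := (simp only [B]; module)) -hGx
  · have h1 : ‖x‖ ^ 2 / ρ ^ 2 ≤ 16 := by
      rw [div_le_iff₀ hρ2]
      calc _ ≤ (4 * ρ) ^ 2 := by gcongr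
        _ = _ := by ring
    have h2 : 0 ≤ ‖x‖ ^ 2 / ρ ^ 2 := by positivity
    rw [sub_sub_cancel_left, abs_neg, abs_mul, abs_of_pos hε]
    have h3 : |1 - ‖x‖ ^ 2 / ρ ^ 2| ≤ 17 := abs_le.2 ⟨by linarith, by linarith⟩
    nlinarith

/-- Krasnosel'skii: with gradient structure, non-zero eigenvalues are
bifurcation points. In a real Hilbert space, let L be compact self-adjoint linear and
R = ∇r continuous, compact and of higher order at 0, with r weakly (sequentially) continuous,
and suppose R has a Fréchet derivative which is bounded and uniformly continuous near 0.
Then every eigenvalue λ₀ ≠ 0 of L is a bifurcation point of λx = Lx + R(x). -/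
theorem stmt5 {X : Type*} [NormedAddCommGroup X] [InnerProductSpace ℝ X] [CompleteSpace X]
    (L : X →L[ℝ] X) (hLc : IsCompactOperator (⇑L))
    (hLsa : ∀ x y : X, ⟪L x, y⟫ = ⟪x, L y⟫)
    (R : X → X) (hRcont : Continuous R)
    (hRcomp : ∀ s : Set X, Bornology.IsBounded s → IsCompact (closure (R '' s)))
    (hsmall : ∀ ε > (0 : ℝ), ∃ δ > (0 : ℝ), ∀ x : X, x ≠ 0 → ‖x‖ < δ → ‖R x‖ ≤ ε * ‖x‖)
    (r : X → ℝ) (hgrad : ∀ x : X, HasGradientAt r (R x) x)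
    (hweak : ∀ (xs : ℕ → X) (x₀ : X),
      (∀ y : X, Tendsto (fun n => ⟪xs n, y⟫) atTop (nhds ⟪x₀, y⟫)) →
      Tendsto (fun n => r (xs n)) atTop (nhds (r x₀)))
    (U : Set X) (hU : U ∈ nhds (0 : X)) (D : X → X →L[ℝ] X)
    (hD : ∀ x ∈ U, HasFDerivAt R (D x) x)
    (hDbdd : ∃ C : ℝ, ∀ x ∈ U, ‖D x‖ ≤ C)
    (hDuc : UniformContinuousOn D U)
    (lam₀ : ℝ) (hlam₀ : lam₀ ≠ 0) (heig : ∃ x : X, x ≠ 0 ∧ L x = lam₀ • x) :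
    ∃ (lams : ℕ → ℝ) (xs : ℕ → X),
      (∀ n, xs n ≠ 0 ∧ lams n • xs n = L (xs n) + R (xs n)) ∧
      Tendsto lams atTop (nhds lam₀) ∧
      Tendsto (fun n => ‖xs n‖) atTop (nhds 0) := by
  have hR0 : R 0 = 0 := by
    obtain ⟨x₁, hx₁, -⟩ := heig
    have : Nontrivial X := ⟨x₁, 0, hx₁⟩
    have := Module.punctured_nhds_neBot ℝ X 0
    obtain ⟨δ, hδ, h⟩ := hsmall 1 one_pos
    have hle : ∀ᶠ x in nhdsWithin (0 : X) {0}ᶜ, ‖R x‖ ≤ 1 * ‖x‖ := by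
      filter_upwards [self_mem_nhdsWithin,
        mem_nhdsWithin_of_mem_nhds (Metric.ball_mem_nhds (0 : X) hδ)] with x hx hxδ
      exact h x hx (by simpa using hxδ)
    have hlim := le_of_tendsto_of_tendsto
      ((hRcont.norm.tendsto 0).mono_left nhdsWithin_le_nhds)
      (((continuous_const.mul continuous_norm).tendsto 0).mono_left nhdsWithin_le_nhds) hle
    simpa using hlim
  have hRfd : HasFDerivAt R (0 : X →L[ℝ] X) 0 := by
    rw [hasFDerivAt_iff_isLittleO, Asymptotics.isLittleO_iff]
    intro c hc
    obtain ⟨δ, hδ, h⟩ := hsmall c hc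
    filter_upwards [Metric.ball_mem_nhds (0 : X) hδ] with x hx
    rcases eq_or_ne x 0 with rfl | hx0
    · simp
    · simpa [hR0] using h x hx0 (by simpa using hx)
  have hRlip : ∀ η > 0, ∃ δ > 0, ∀ x y : X, ‖x‖ ≤ δ → ‖y‖ ≤ δ → ‖R x - R y‖ ≤ η * ‖x - y‖ :=
    fun η hη => exists_closedBall_lipschitz_of_fderiv_zero hRfd (Filter.mem_of_superset hU hD)
      (hDuc.continuousOn.continuousAt hU) hη
  choose lams xs hx0 hsol hlam hxs using fun n : ℕ =>
    exists_small_solution hLc hLsa hR0 hRlip hgrad hlam₀ heig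
      (δ := 1 / ((n : ℝ) + 1)) (by positivity)
  refine ⟨lams, xs, fun n => ⟨hx0 n, hsol n⟩, ?_, ?_⟩
  · rw [tendsto_iff_norm_sub_tendsto_zero]
    exact squeeze_zero (fun _ => norm_nonneg _) hlam tendsto_one_div_add_atTop_nhds_zero_nat
  · exact squeeze_zero (fun _ => norm_nonneg _) hxs tendsto_one_div_add_atTop_nhds_zero_nat
end

section
/- (Whitney.) For any closed set G ⊆ ℝⁿ there exists a function h : ℝⁿ → [0, ∞) which is infinitely differentiable (C^∞) on ℝⁿ and globally Lipschitz continuous, such that G = {x ∈ ℝⁿ : h(x) = 0} and, for every point x ∈ G and every k ≥ 1, the k-th derivative of h at x is zero. -/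
open Function Set Topology

/-- An open set is the union of the supports of a sequence of nonnegative smooth bump functions,
each compactly supported inside the set. -/
theorem IsOpen.exists_seq_contDiff_iUnion_support_eq {E : Type*} [NormedAddCommGroup E]
    [NormedSpace ℝ E] [FiniteDimensional ℝ E] {s : Set E} (hs : IsOpen s) :
    ∃ g : ℕ → E → ℝ, (∀ i, tsupport (g i) ⊆ s) ∧ (∀ i, HasCompactSupport (g i)) ∧
      (∀ i, ContDiff ℝ (⊤ : ℕ∞) (g i)) ∧ (∀ i x, 0 ≤ g i x) ∧ ∀ x ∈ s, ∃ i, g i x ≠ 0 := by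
  rcases s.eq_empty_or_nonempty with rfl | hne
  · exact ⟨fun _ _ => 0, by simp [tsupport], fun _ => HasCompactSupport.zero,
      fun _ => contDiff_const, fun _ _ => le_rfl, by simp⟩
  choose f f_supp f_comp f_smooth f_range f_one using fun x : s =>
    exists_contDiff_tsupport_subset (n := ⊤) (hs.mem_nhds x.2)
  obtain ⟨T, T_count, hT⟩ := TopologicalSpace.isOpen_iUnion_countable (fun x : s => support (f x))
    fun x => (f_smooth x).continuous.isOpen_support
  have hcover : ∀ x ∈ s, ∃ y ∈ T, f y x ≠ 0 := fun x hx => by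
    have : x ∈ ⋃ y ∈ T, support (f y) := by
      rw [hT]
      exact mem_iUnion_of_mem ⟨x, hx⟩ (by simp [f_one])
    simpa using this
  obtain ⟨x, hx⟩ := hne
  obtain ⟨y, hy, -⟩ := hcover x hx
  obtain ⟨e, rfl⟩ := T_count.exists_eq_range ⟨y, hy⟩
  refine ⟨fun i => f (e i), fun i => f_supp _, fun i => f_comp _, fun i => f_smooth _,
    fun i x => (f_range _ (mem_range_self x)).1, fun x hx => ?_⟩
  obtain ⟨_, ⟨i, rfl⟩, hi⟩ := hcover x hx
  exact ⟨i, hi⟩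

/-- Smooth compactly supported functions can be rescaled by positive factors so that for every
order `k` the `k`-th derivatives are uniformly bounded by the terms of a summable series. -/
theorem exists_pos_smul_iteratedFDeriv_summable_bound {E : Type*} [NormedAddCommGroup E]
    [NormedSpace ℝ E] {g : ℕ → E → ℝ} (g_comp : ∀ i, HasCompactSupport (g i))
    (g_smooth : ∀ i, ContDiff ℝ (⊤ : ℕ∞) (g i)) :
    ∃ (r : ℕ → ℝ) (v : ℕ → ℕ → ℝ), (∀ i, 0 < r i) ∧ (∀ k, Summable (v k)) ∧
      ∀ k i x, ‖iteratedFDeriv ℝ k (r i • g i) x‖ ≤ v k i := by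
  have hbound : ∀ k i, ∃ R, ∀ x, ‖iteratedFDeriv ℝ k (g i) x‖ ≤ R := fun k i =>
    ((g_comp i).iteratedFDeriv k).exists_bound_of_continuous
      ((g_smooth i).continuous_iteratedFDeriv (mod_cast le_top))
  choose R hR using hbound
  have R_nonneg : ∀ k i, 0 ≤ R k i := fun k i => (norm_nonneg _).trans (hR k i 0)
  have M_pos : ∀ i, 0 < 1 + ∑ k ∈ Finset.range (i + 1), R k i := fun i =>
    add_pos_of_pos_of_nonneg one_pos (Finset.sum_nonneg fun k _ => R_nonneg k i)
  let r : ℕ → ℝ := fun i => (1 / 2) ^ i / (1 + ∑ k ∈ Finset.range (i + 1), R k i)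
  have r_pos : ∀ i, 0 < r i := fun i => div_pos (by positivity) (M_pos i)
  refine ⟨r, fun k i => r i * R k i, r_pos, fun k => ?_, fun k i x => ?_⟩
  · refine Summable.of_norm_bounded_eventually_nat summable_geometric_two ?_
    filter_upwards [Filter.eventually_ge_atTop k] with i hi
    rw [Real.norm_of_nonneg (mul_nonneg (r_pos i).le (R_nonneg k i)), div_mul_eq_mul_div,
      div_le_iff₀ (M_pos i)]
    have := Finset.single_le_sum (fun j _ => R_nonneg j i)
      (Finset.mem_range.2 (Nat.lt_succ_of_le hi))
    gcongr
    linarith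
  · rw [iteratedFDeriv_const_smul_apply ((g_smooth i).contDiffAt.of_le (mod_cast le_top)),
      norm_smul, Real.norm_of_nonneg (r_pos i).le]
    exact mul_le_mul_of_nonneg_left (hR k i x) (r_pos i).le


/-- Whitney: for any closed set G ⊆ ℝⁿ there is an infinitely differentiable,
globally Lipschitz function h : ℝⁿ → [0,∞) whose zero set is exactly G and all of whose
derivatives (of order k ≥ 1) vanish at every point of G. -/
theorem stmt8 {n : ℕ} (G : Set (EuclideanSpace ℝ (Fin n))) (hG : IsClosed G) :
    ∃ h : EuclideanSpace ℝ (Fin n) → ℝ,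
      (∀ x, 0 ≤ h x) ∧
      ContDiff ℝ (⊤ : ℕ∞) h ∧
      (∃ K : NNReal, LipschitzWith K h) ∧
      G = {x | h x = 0} ∧
      (∀ x ∈ G, ∀ k : ℕ, 1 ≤ k → iteratedFDeriv ℝ k h x = 0) := by
  obtain ⟨g, g_supp, g_comp, g_smooth, g_nonneg, g_ne⟩ :=
    hG.isOpen_compl.exists_seq_contDiff_iUnion_support_eq
  obtain ⟨r, v, r_pos, v_summable, hv⟩ :=
    exists_pos_smul_iteratedFDeriv_summable_bound g_comp g_smooth
  have f_smooth : ∀ i, ContDiff ℝ (⊤ : ℕ∞) (r i • g i) := fun i => (g_smooth i).const_smul (r i)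
  have f_nonneg : ∀ x i, 0 ≤ (r i • g i) x := fun x i => mul_nonneg (r_pos i).le (g_nonneg i x)
  have f_summable : ∀ x, Summable fun i => (r i • g i) x := fun x =>
    .of_norm_bounded (v_summable 0) fun i => by
      simpa only [norm_iteratedFDeriv_zero] using hv 0 i x
  have h_smooth : ContDiff ℝ (⊤ : ℕ∞) fun x => ∑' i, (r i • g i) x :=
    contDiff_tsum f_smooth (fun k _ => v_summable k) fun k i x _ => hv k i x
  have h_deriv : ∀ k x, iteratedFDeriv ℝ k (fun x => ∑' i, (r i • g i) x) x =
      ∑' i, iteratedFDeriv ℝ k (r i • g i) x := fun k x =>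
    iteratedFDeriv_tsum_apply f_smooth (fun k _ => v_summable k) (fun k i x _ => hv k i x)
      (mod_cast le_top) x
  have f_flat : ∀ x ∈ G, ∀ k i, iteratedFDeriv ℝ k (r i • g i) x = 0 := fun x hx k i => by
    refine image_eq_zero_of_notMem_tsupport fun hmem => g_supp i ?_ hx
    exact tsupport_smul_subset_right (fun _ => r i) (g i) (tsupport_iteratedFDeriv_subset k hmem)
  refine ⟨fun x => ∑' i, (r i • g i) x, fun x => tsum_nonneg (f_nonneg x), h_smooth,
    ⟨(∑' i, v 1 i).toNNReal, ?_⟩, ?_, fun x hx k _ => ?_⟩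
  · refine lipschitzWith_of_nnnorm_fderiv_le (h_smooth.differentiable (by simp)) fun x => ?_
    rw [← NNReal.coe_le_coe, coe_nnnorm, ← norm_iteratedFDeriv_one, h_deriv]
    exact (tsum_of_norm_bounded (v_summable 1).hasSum fun i => hv 1 i x).trans
      (Real.le_coe_toNNReal _)
  · ext x
    refine ⟨fun hx => ?_, fun hx => ?_⟩
    · have hzero : ∀ i, g i x = 0 := fun i =>
        image_eq_zero_of_notMem_tsupport fun hmem => g_supp i hmem hx
      simp [hzero]
    · by_contra hxG
      obtain ⟨i, hi⟩ := g_ne x hxG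
      exact ((f_summable x).tsum_pos (f_nonneg x) i
        (mul_pos (r_pos i) ((g_nonneg i x).lt_of_ne' hi))).ne' hx
  · rw [h_deriv]
    simp [f_flat x hx]
end

section
/- For every α > 0 there exists a function ω : ℝ² → ℝ with the following properties: (a) ω(λ, x) = 0 whenever |x| ≥ α|λ|/2; (b) λ·ω(λ, x) ≥ 0 for all (λ, x) ∈ ℝ²; (c) ω(λ, 0) = λ for all λ ∈ ℝ; (d) ω is infinitely differentiable on ℝ² \ {(0,0)}; (e) ω is globally Lipschitz continuous on ℝ². -/
open Set

/-- The degree-one homogeneous extension `(l, x) ↦ l χ(x / l)` of a function `χ` of the slope. -/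
noncomputable def slopeExtension (χ : ℝ → ℝ) (p : ℝ × ℝ) : ℝ :=
  p.1 * χ (p.2 / p.1)

section slopeExtension

variable {χ : ℝ → ℝ} {r : ℝ}

theorem slopeExtension_eq_zero (hχ : ∀ t, r ≤ |t| → χ t = 0) {l x : ℝ} (h : r * |l| ≤ |x|) :
    slopeExtension χ (l, x) = 0 := by
  rcases eq_or_ne l 0 with rfl | hl
  · simp [slopeExtension]
  · have : χ (x / l) = 0 := hχ _ (by rwa [abs_div, le_div_iff₀ (abs_pos.2 hl)])
    simp [slopeExtension, this]

theorem contDiffOn_slopeExtension (hsmooth : ContDiff ℝ (⊤ : ℕ∞) χ)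
    (hχ : ∀ t, r ≤ |t| → χ t = 0) :
    ContDiffOn ℝ (⊤ : ℕ∞) (slopeExtension χ) ({((0 : ℝ), (0 : ℝ))}ᶜ) := by
  rintro ⟨l, x⟩ hp
  refine ContDiffAt.contDiffWithinAt ?_
  rcases eq_or_ne l 0 with rfl | hl
  · have hx : x ≠ 0 := by rintro rfl; exact hp rfl
    have hopen : IsOpen {p : ℝ × ℝ | r * |p.1| < |p.2|} :=
      isOpen_lt (by fun_prop) (by fun_prop)
    have hzero : slopeExtension χ =ᶠ[nhds (0, x)] fun _ => 0 := by
      filter_upwards [hopen.mem_nhds (by simpa using hx : ((0 : ℝ), x) ∈ _)] with p hp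
      exact slopeExtension_eq_zero hχ (le_of_lt hp)
    exact contDiffAt_const.congr_of_eventuallyEq hzero
  · exact contDiffAt_fst.mul
      (hsmooth.contDiffAt.comp (l, x) (contDiffAt_snd.div contDiffAt_fst hl))

theorem abs_slopeExtension_sub_snd_le {C : NNReal} (hC : LipschitzWith C χ) (l x y : ℝ) :
    |slopeExtension χ (l, x) - slopeExtension χ (l, y)| ≤ C * |x - y| := by
  rcases eq_or_ne l 0 with rfl | hl
  · simp only [slopeExtension, zero_mul, sub_zero, abs_zero]
    positivity
  · have h := hC.dist_le_mul (x / l) (y / l)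
    rw [Real.dist_eq, Real.dist_eq, ← sub_div, abs_div] at h
    calc |slopeExtension χ (l, x) - slopeExtension χ (l, y)|
        = |l| * |χ (x / l) - χ (y / l)| := by
          rw [slopeExtension, slopeExtension, ← mul_sub, abs_mul]
      _ ≤ |l| * (C * (|x - y| / |l|)) := by gcongr
      _ = C * |x - y| := by
        have := abs_pos.2 hl
        field_simp

theorem abs_slopeExtension_sub_fst_le_of_slope_le {C : NNReal} (hC : LipschitzWith C χ)
    (hbound : ∀ t, |χ t| ≤ 1) {l m x : ℝ} (hl : l ≠ 0) (hm : m ≠ 0) (hx : |x / l| ≤ r) :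
    |slopeExtension χ (l, x) - slopeExtension χ (m, x)| ≤ (1 + C * r) * |l - m| := by
  have h := hC.dist_le_mul (x / l) (x / m)
  rw [Real.dist_eq, Real.dist_eq] at h
  have hslope : |m| * |x / l - x / m| = |x / l| * |l - m| := by
    rw [← abs_mul, ← abs_mul, abs_eq_abs]
    right
    field_simp
    ring
  calc |slopeExtension χ (l, x) - slopeExtension χ (m, x)|
      = |(l - m) * χ (x / l) + m * (χ (x / l) - χ (x / m))| := by
        simp only [slopeExtension]; ring_nf
    _ ≤ |l - m| * |χ (x / l)| + |m| * |χ (x / l) - χ (x / m)| := by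
        rw [← abs_mul, ← abs_mul]; exact abs_add_le _ _
    _ ≤ |l - m| * 1 + |m| * (C * |x / l - x / m|) := by gcongr; exact hbound _
    _ = |l - m| + C * (|x / l| * |l - m|) := by rw [← hslope]; ring
    _ ≤ |l - m| + C * (r * |l - m|) := by gcongr
    _ = (1 + C * r) * |l - m| := by ring

theorem abs_slopeExtension_sub_fst_le {C : NNReal} (hC : LipschitzWith C χ) (hr : 0 ≤ r)
    (hχ : ∀ t, r ≤ |t| → χ t = 0) (hbound : ∀ t, |χ t| ≤ 1) (l m x : ℝ) :
    |slopeExtension χ (l, x) - slopeExtension χ (m, x)| ≤ (1 + C * r) * |l - m| := by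
  have hone : 1 ≤ 1 + C * r := le_add_of_nonneg_right (by positivity)
  have habs (k : ℝ) : |slopeExtension χ (k, x)| ≤ (1 + C * r) * |k| := by
    rw [slopeExtension, abs_mul, mul_comm]
    exact mul_le_mul_of_nonneg_right ((hbound _).trans hone) (abs_nonneg _)
  rcases eq_or_ne l 0 with rfl | hl
  · simpa [slopeExtension] using habs m
  rcases eq_or_ne m 0 with rfl | hm
  · simpa [slopeExtension] using habs l
  rcases le_total |x / l| r with hxl | hxl
  · exact abs_slopeExtension_sub_fst_le_of_slope_le hC hbound hl hm hxl
  rcases le_total |x / m| r with hxm | hxm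
  · rw [abs_sub_comm, abs_sub_comm l]
    exact abs_slopeExtension_sub_fst_le_of_slope_le hC hbound hm hl hxm
  · simp only [slopeExtension, hχ _ hxl, hχ _ hxm, mul_zero, sub_zero, abs_zero]
    positivity

theorem exists_lipschitzWith_slopeExtension {C : NNReal} (hC : LipschitzWith C χ) (hr : 0 ≤ r)
    (hχ : ∀ t, r ≤ |t| → χ t = 0) (hbound : ∀ t, |χ t| ≤ 1) :
    ∃ K : NNReal, LipschitzWith K (slopeExtension χ) := by
  refine ⟨_, LipschitzWith.of_dist_le' (K := C + (1 + C * r)) ?_⟩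
  rintro ⟨l, x⟩ ⟨m, y⟩
  have hfst : |l - m| ≤ dist (l, x) (m, y) := le_max_left _ _
  have hsnd : |x - y| ≤ dist (l, x) (m, y) := le_max_right _ _
  calc dist (slopeExtension χ (l, x)) (slopeExtension χ (m, y))
      ≤ |slopeExtension χ (l, x) - slopeExtension χ (l, y)| +
          |slopeExtension χ (l, y) - slopeExtension χ (m, y)| := dist_triangle _ _ _
    _ ≤ C * |x - y| + (1 + C * r) * |l - m| :=
        add_le_add (abs_slopeExtension_sub_snd_le hC l x y)
          (abs_slopeExtension_sub_fst_le hC hr hχ hbound l m y)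
    _ ≤ C * dist (l, x) (m, y) + (1 + C * r) * dist (l, x) (m, y) := by gcongr
    _ = (C + (1 + C * r)) * dist (l, x) (m, y) := by ring

end slopeExtension

/-- for every α > 0 there is ω : ℝ² → ℝ with
(a) ω(λ,x) = 0 whenever |x| ≥ α|λ|/2;
(b) λ·ω(λ,x) ≥ 0 everywhere;
(c) ω(λ,0) = λ;
(d) ω infinitely differentiable on ℝ² \ {(0,0)};
(e) ω globally Lipschitz on ℝ². -/
theorem stmt12 (α : ℝ) (hα : 0 < α) :
    ∃ ω : ℝ × ℝ → ℝ,
      (∀ l x : ℝ, α * |l| / 2 ≤ |x| → ω (l, x) = 0) ∧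
      (∀ l x : ℝ, 0 ≤ l * ω (l, x)) ∧
      (∀ l : ℝ, ω (l, 0) = l) ∧
      ContDiffOn ℝ (⊤ : ℕ∞) ω ({((0 : ℝ), (0 : ℝ))}ᶜ) ∧
      (∃ K : NNReal, LipschitzWith K ω) := by
  let χ : ContDiffBump (0 : ℝ) := ⟨α / 4, α / 2, by positivity, by linarith⟩
  have hχ (t : ℝ) (ht : α / 2 ≤ |t|) : χ t = 0 := χ.zero_of_le_dist (by simpa using ht)
  have hbound (t : ℝ) : |χ t| ≤ 1 := by rw [abs_of_nonneg χ.nonneg]; exact χ.le_one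
  have hsmooth : ContDiff ℝ (⊤ : ℕ∞) χ := χ.contDiff
  obtain ⟨C, hC⟩ := hsmooth.lipschitzWith_of_hasCompactSupport χ.hasCompactSupport (by simp)
  refine ⟨slopeExtension χ, fun l x h => slopeExtension_eq_zero hχ (by linarith), fun l x => ?_,
    fun l => ?_, contDiffOn_slopeExtension hsmooth hχ,
    exists_lipschitzWith_slopeExtension hC (by positivity) hχ hbound⟩
  · rw [slopeExtension, ← mul_assoc]
    exact mul_nonneg (mul_self_nonneg l) χ.nonneg
  · have : χ 0 = 1 := χ.one_of_mem_closedBall (by simp [χ.rIn_pos.le])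
    simp [slopeExtension, this]
end

section
/- Let 0 < α < β and suppose G ⊆ ℝ² satisfies hypothesis (ℋ). Then there exists a globally Lipschitz continuous function g : ℝ² → ℝ which is infinitely differentiable on ℝ² \ {(0,0)}, satisfies g(λ, 0) = λ for all λ ∈ ℝ, and whose zero set is exactly G: g(λ, x) = 0 if and only if (λ, x) ∈ G. -/
open Set

/-- The double cone C(α,β) = {(λ,x) : 0 < αλ < x < βλ or 0 > αλ > x > βλ} ∪ {(0,0)}. -/
def cone (a b : ℝ) : Set (ℝ × ℝ) :=
  {p : ℝ × ℝ | (0 < a * p.1 ∧ a * p.1 < p.2 ∧ p.2 < b * p.1) ∨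
    (a * p.1 < 0 ∧ p.2 < a * p.1 ∧ b * p.1 < p.2)} ∪ {((0 : ℝ), (0 : ℝ))}

/-- H⁺: the connected component of ℝ² \ G containing D⁺, the component of ℝ² \ C(α,β)
containing the positive λ-axis (represented by the point (1,0)). -/
def Hplus (G : Set (ℝ × ℝ)) : Set (ℝ × ℝ) :=
  connectedComponentIn Gᶜ ((1 : ℝ), (0 : ℝ))

/-- H⁻: the connected component of ℝ² \ G containing D⁻, the component of ℝ² \ C(α,β)
containing the negative λ-axis (represented by the point (−1,0)). -/
def Hminus (G : Set (ℝ × ℝ)) : Set (ℝ × ℝ) :=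
  connectedComponentIn Gᶜ ((-1 : ℝ), (0 : ℝ))

/-- Hypothesis (ℋ): G ⊆ C(α,β) is closed, connected, unbounded in both half-planes
{λ ≥ 0} and {λ ≤ 0}, and H⁺ ∩ H⁻ = ∅. -/
def hypH (a b : ℝ) (G : Set (ℝ × ℝ)) : Prop :=
  G ⊆ cone a b ∧ IsClosed G ∧ IsConnected G ∧
  ¬ Bornology.IsBounded (G ∩ {p : ℝ × ℝ | 0 ≤ p.1}) ∧
  ¬ Bornology.IsBounded (G ∩ {p : ℝ × ℝ | p.1 ≤ 0}) ∧
  Hplus G ∩ Hminus G = ∅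

/-- Every open subset of the plane is the support of a nonnegative, globally Lipschitz smooth
function. -/
theorem exists_contDiff_lipschitz_support_eq {U : Set (ℝ × ℝ)} (hU : IsOpen U) :
    ∃ h : ℝ × ℝ → ℝ, ContDiff ℝ (⊤ : ℕ∞) h ∧ (∃ K : NNReal, LipschitzWith K h) ∧
      (∀ p, 0 ≤ h p) ∧ ∀ p, h p ≠ 0 ↔ p ∈ U := by
  set I : Set ℝ := Ioo (-(Real.pi / 2)) (Real.pi / 2)
  have htan : ContinuousOn (fun q : ℝ × ℝ => (Real.tan q.1, Real.tan q.2)) (I ×ˢ I) :=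
    (Real.continuousOn_tan_Ioo.comp continuousOn_fst fun q hq => hq.1).prodMk
      (Real.continuousOn_tan_Ioo.comp continuousOn_snd fun q hq => hq.2)
  have hV := htan.isOpen_inter_preimage (isOpen_Ioo.prod isOpen_Ioo) hU
  obtain ⟨f, hfs, hfc, hfr⟩ := hV.exists_contDiff_support_eq (n := (⊤ : ℕ∞))
  set ρ : ℝ × ℝ → ℝ × ℝ := fun p => (Real.arctan p.1, Real.arctan p.2) with hρ
  have hρc : ContDiff ℝ (⊤ : ℕ∞) ρ :=
    (Real.contDiff_arctan.comp contDiff_fst).prodMk (Real.contDiff_arctan.comp contDiff_snd)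
  have hatan : LipschitzWith 1 Real.arctan := by
    refine lipschitzWith_of_nnnorm_deriv_le Real.differentiable_arctan fun x => ?_
    rw [← NNReal.coe_le_coe, coe_nnnorm, Real.deriv_arctan, Real.norm_eq_abs,
      abs_of_nonneg (by positivity), NNReal.coe_one, div_le_one (by positivity)]
    nlinarith [sq_nonneg x]
  have hρl : LipschitzWith 1 ρ := by
    have := (hatan.comp LipschitzWith.prod_fst).prodMk (hatan.comp LipschitzWith.prod_snd)
    simpa using this
  have hρm : ∀ p, ρ p ∈ I ×ˢ I := fun p => ⟨Real.arctan_mem_Ioo _, Real.arctan_mem_Ioo _⟩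
  set J : Set ℝ := Icc (-(Real.pi / 2)) (Real.pi / 2)
  obtain ⟨K, hK⟩ : ∃ K : NNReal, LipschitzOnWith K f (J ×ˢ J) :=
    (hfc.of_le (by simp) : ContDiff ℝ 1 f).contDiffOn.exists_lipschitzOnWith (by simp)
      ((convex_Icc _ _).prod (convex_Icc _ _)) (isCompact_Icc.prod isCompact_Icc)
  refine ⟨f ∘ ρ, hfc.comp hρc, ⟨K * 1, ?_⟩, fun p => (hfr ⟨_, rfl⟩).1, fun p => ?_⟩
  · rw [← lipschitzOnWith_univ]
    exact hK.comp (hρl.lipschitzOnWith) fun p _ =>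
      ⟨Ioo_subset_Icc_self (hρm p).1, Ioo_subset_Icc_self (hρm p).2⟩
  · change ρ p ∈ Function.support f ↔ _
    rw [hfs]
    rw [mem_inter_iff, and_iff_right (hρm p)]
    simp only [mem_preimage, hρ, Real.tan_arctan, Prod.mk.eta]

/-- The complement, inside an open set, of one of its connected components is open. -/
theorem IsOpen.diff_connectedComponentIn {X : Type*} [TopologicalSpace X]
    [LocallyConnectedSpace X] {U : Set X} (hU : IsOpen U) (x : X) :
    IsOpen (U \ connectedComponentIn U x) := by
  refine isOpen_iff_forall_mem_open.2 fun y hy => ?_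
  refine ⟨connectedComponentIn U y, fun z hz => ⟨connectedComponentIn_subset _ _ hz, fun hzx => ?_⟩,
    hU.connectedComponentIn, mem_connectedComponentIn hy.1⟩
  apply hy.2
  rw [connectedComponentIn_eq hzx, ← connectedComponentIn_eq hz]
  exact mem_connectedComponentIn hy.1

/-- A Lipschitz function, smooth off the origin, that extends `(l, 0) ↦ l`, has the sign of the
first coordinate and vanishes outside a thin double cone around the axis. -/
theorem exists_lipschitz_extension_supported_near_axis {a : ℝ} (ha : 0 < a) :
    ∃ k : ℝ × ℝ → ℝ, (∃ K : NNReal, LipschitzWith K k) ∧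
      (∀ p, p ≠ 0 → ContDiffAt ℝ (⊤ : ℕ∞) k p) ∧ (∀ l : ℝ, k (l, 0) = l) ∧
      (∀ p, k p ≠ 0 → |p.2| < a * |p.1|) ∧ (∀ p, 0 ≤ k p * p.1) := by
  let φ : ContDiffBump (0 : ℝ) := ⟨a / 2, a, by positivity, by linarith⟩
  have hφ : ContDiff ℝ (⊤ : ℕ∞) φ := φ.contDiff
  have hφd : Differentiable ℝ φ := hφ.differentiable (by simp)
  have hφ0 : ∀ t : ℝ, a ≤ |t| → φ t = 0 := fun t ht =>
    φ.zero_of_le_dist (by simpa [Real.dist_eq] using ht)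
  set k : ℝ × ℝ → ℝ := fun p => p.1 * φ (p.2 / p.1) with hk
  have hsupp : ∀ p, k p ≠ 0 → |p.2| < a * |p.1| := by
    intro p hp
    have h1 : p.1 ≠ 0 := left_ne_zero_of_mul hp
    have h2 := right_ne_zero_of_mul hp
    by_contra! h
    apply h2 (hφ0 _ _)
    rwa [abs_div, le_div_iff₀ (abs_pos.2 h1)]
  have hsmooth : ∀ p, p ≠ 0 → ContDiffAt ℝ (⊤ : ℕ∞) k p := by
    intro p hp
    by_cases h1 : p.1 = 0
    · have h2 : p.2 ≠ 0 := fun h2 => hp (Prod.ext h1 h2)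
      have hop : IsOpen {q : ℝ × ℝ | a * |q.1| < |q.2|} :=
        isOpen_lt (by fun_prop) (by fun_prop)
      have hev : k =ᶠ[nhds p] fun _ => 0 := by
        filter_upwards [hop.mem_nhds (by simpa [h1] using h2)] with q hq
        by_contra h
        exact lt_asymm hq (hsupp q h)
      exact contDiffAt_const.congr_of_eventuallyEq hev
    · exact contDiffAt_fst.mul
        (hφ.contDiffAt.comp p (contDiffAt_snd.div contDiffAt_fst h1))
  obtain ⟨L, hL⟩ : ∃ L : NNReal, LipschitzWith L φ :=
    hφ.lipschitzWith_of_hasCompactSupport φ.hasCompactSupport (by simp)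
  obtain ⟨M, hM⟩ : ∃ M, ∀ t : ℝ, ‖φ t - t * deriv φ t‖ ≤ M := by
    have hc : HasCompactSupport fun t : ℝ => φ t - t * deriv φ t :=
      φ.hasCompactSupport.sub (φ.hasCompactSupport.deriv.mul_left)
    exact hc.exists_bound_of_continuous
      (φ.continuous.sub (continuous_id.mul (hφ.continuous_deriv (by simp))))
  have hM0 : 0 ≤ M := (norm_nonneg _).trans (hM 0)
  have hone : ∀ l, k (l, 0) = l := fun l => by
    have : φ 0 = 1 := φ.one_of_mem_closedBall (by simpa [φ] using (half_pos ha).le)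
    simp [hk, this]
  have hx : ∀ l x y : ℝ, |k (l, x) - k (l, y)| ≤ L * |x - y| := by
    intro l x y
    rcases eq_or_ne l 0 with rfl | hl
    · simp only [hk, zero_mul, sub_self, abs_zero]; positivity
    · have := hL.dist_le_mul (x / l) (y / l)
      rw [Real.dist_eq, Real.dist_eq, ← sub_div, abs_div] at this
      simp only [hk, ← mul_sub, abs_mul]
      calc _ ≤ |l| * (L * (|x - y| / |l|)) := by gcongr
        _ = _ := by field_simp
  have hl : ∀ x l m : ℝ, |k (l, x) - k (m, x)| ≤ max M 1 * |l - m| := by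
    intro x l m
    rcases eq_or_ne x 0 with rfl | hx0
    · rw [hone, hone]
      exact le_mul_of_one_le_left (abs_nonneg _) (le_max_right _ _)
    have hdiff : ∀ l : ℝ, DifferentiableAt ℝ (fun l => k (l, x)) l := fun l =>
      DifferentiableAt.comp (g := k) (f := fun l => (l, x)) l
        ((hsmooth (l, x) (by simp [hx0])).differentiableAt (by simp))
        (differentiableAt_id.prodMk (differentiableAt_const x))
    have hd : ∀ l : ℝ, ‖deriv (fun l => k (l, x)) l‖ ≤ max M 1 := by
      intro l
      rcases eq_or_ne l 0 with rfl | hl0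
      · have hev : (fun l => k (l, x)) =ᶠ[nhds 0] fun _ => 0 := by
          have hop : IsOpen {l : ℝ | a * |l| < |x|} := isOpen_lt (by fun_prop) (by fun_prop)
          filter_upwards [hop.mem_nhds (by simpa using hx0)] with q hq
          by_contra h
          exact lt_asymm hq (hsupp _ h)
        rw [hev.deriv_eq]
        simp
      · have h1 : HasDerivAt (fun l : ℝ => x / l) (-x / l ^ 2) l := by
          refine ((hasDerivAt_const l x).fun_div (hasDerivAt_id' l) hl0).congr_deriv ?_
          simp
        have h2 : HasDerivAt (fun l => k (l, x)) (φ (x / l) - x / l * deriv φ (x / l)) l := by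
          refine ((hasDerivAt_id' l).fun_mul
            ((hφd (x / l)).hasDerivAt.comp l h1)).congr_deriv ?_
          simp only [Function.comp]
          field_simp
          ring
        rw [h2.deriv]
        exact (hM _).trans (le_max_left _ _)
    simpa [Real.norm_eq_abs] using convex_univ.norm_image_sub_le_of_norm_deriv_le
      (fun l _ => hdiff l) (fun l _ => hd l) (mem_univ m) (mem_univ l)
  refine ⟨k, ⟨L + (max M 1).toNNReal, ?_⟩, hsmooth, hone, hsupp, fun p => ?_⟩
  · refine LipschitzWith.of_dist_le_mul fun p q => ?_
    have h1 : |p.1 - q.1| ≤ dist p q := by rw [← Real.dist_eq]; exact le_max_left _ _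
    have h2 : |p.2 - q.2| ≤ dist p q := by rw [← Real.dist_eq]; exact le_max_right _ _
    rw [Real.dist_eq, NNReal.coe_add, Real.coe_toNNReal _ (le_max_of_le_left hM0), add_mul]
    calc |k p - k q| ≤ |k (p.1, p.2) - k (p.1, q.2)| + |k (p.1, q.2) - k (q.1, q.2)| :=
          abs_sub_le _ _ _
      _ ≤ L * |p.2 - q.2| + max M 1 * |p.1 - q.1| := add_le_add (hx _ _ _) (hl _ _ _)
      _ ≤ _ := by gcongr
  · have : 0 ≤ φ (p.2 / p.1) := φ.nonneg
    have : k p * p.1 = p.1 ^ 2 * φ (p.2 / p.1) := by simp only [hk]; ring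
    rw [this]
    positivity

/-- A connected subset of the double cone that is unbounded on both sides contains the origin. -/
theorem hypH.zero_mem {a b : ℝ} {G : Set (ℝ × ℝ)} (hG : hypH a b G) :
    (0 : ℝ × ℝ) ∈ G := by
  obtain ⟨hsub, -, hconn, hr, hl, -⟩ := hG
  have hzero : ∀ p ∈ G, p.1 = 0 → p = 0 := by
    intro p hp h
    rcases hsub hp with h' | h'
    · simp [h] at h'
    · exact h'
  by_contra h0
  have hne : ∀ p ∈ G, p.1 ≠ 0 := fun p hp h => h0 (hzero p hp h ▸ hp)
  obtain ⟨p, hp, hp1⟩ : (G ∩ {p : ℝ × ℝ | 0 ≤ p.1}).Nonempty :=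
    nonempty_iff_ne_empty.2 fun h => hr (h ▸ Bornology.isBounded_empty)
  obtain ⟨q, hq, hq1⟩ : (G ∩ {p : ℝ × ℝ | p.1 ≤ 0}).Nonempty :=
    nonempty_iff_ne_empty.2 fun h => hl (h ▸ Bornology.isBounded_empty)
  obtain ⟨r, hr, hr1⟩ := hconn.isPreconnected.intermediate_value hq hp
    continuous_fst.continuousOn (show (0 : ℝ) ∈ Icc q.1 p.1 from ⟨hq1, hp1⟩)
  exact hne r hr hr1

/-- The cone avoids the thin double cone around the first axis. -/
theorem le_abs_snd_of_mem_cone {a b : ℝ} (ha : 0 < a) {p : ℝ × ℝ} (hp : p ∈ cone a b) :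
    a * |p.1| ≤ |p.2| := by
  rcases hp with (⟨h, h', -⟩ | ⟨h, h', -⟩) | rfl
  · rw [← abs_of_pos ha, ← abs_mul, abs_of_pos h]
    exact h'.le.trans (le_abs_self _)
  · rw [← abs_of_pos ha, ← abs_mul, abs_of_neg h]
    exact (neg_le_neg h'.le).trans (neg_le_abs _)
  · simp

theorem mem_Hplus_of_abs_snd_lt {a b : ℝ} (ha : 0 < a) {G : Set (ℝ × ℝ)} (hG : G ⊆ cone a b)
    {p : ℝ × ℝ} (hp : 0 < p.1) (h : |p.2| < a * |p.1|) : p ∈ Hplus G := by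
  have hconv : Convex ℝ {q : ℝ × ℝ | |q.2| < a * q.1} := by
    intro x hx y hy s t hs ht hst
    simp only [mem_ofPred_eq, abs_lt] at hx hy ⊢
    simp only [Prod.snd_add, Prod.smul_snd, Prod.fst_add, Prod.smul_fst, smul_eq_mul]
    constructor <;> rcases hs.eq_or_lt with rfl | hs' <;> (try rw [zero_add] at hst; subst hst) <;>
      nlinarith
  refine hconv.isPreconnected.subset_connectedComponentIn (by simpa using ha) ?_
    (by simpa [abs_of_pos hp] using h)
  intro q hq hqG
  have h1 := le_abs_snd_of_mem_cone ha (hG hqG)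
  have h2 : a * q.1 ≤ a * |q.1| := by gcongr; exact le_abs_self _
  exact (h1.trans_lt hq).not_ge h2

theorem mem_Hminus_of_abs_snd_lt {a b : ℝ} (ha : 0 < a) {G : Set (ℝ × ℝ)} (hG : G ⊆ cone a b)
    {p : ℝ × ℝ} (hp : p.1 < 0) (h : |p.2| < a * |p.1|) : p ∈ Hminus G := by
  have hconv : Convex ℝ {q : ℝ × ℝ | |q.2| < a * -q.1} := by
    intro x hx y hy s t hs ht hst
    simp only [mem_ofPred_eq, abs_lt] at hx hy ⊢
    simp only [Prod.snd_add, Prod.smul_snd, Prod.fst_add, Prod.smul_fst, smul_eq_mul]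
    constructor <;> rcases hs.eq_or_lt with rfl | hs' <;> (try rw [zero_add] at hst; subst hst) <;>
      nlinarith
  refine hconv.isPreconnected.subset_connectedComponentIn (by simpa using ha) ?_
    (by simpa [abs_of_neg hp] using h)
  intro q hq hqG
  have h1 := le_abs_snd_of_mem_cone ha (hG hqG)
  have h2 : a * -q.1 ≤ a * |q.1| := by gcongr; exact neg_le_abs _
  exact (h1.trans_lt hq).not_ge h2

/-- if G satisfies (ℋ) then there is a globally Lipschitz g : ℝ² → ℝ,
infinitely differentiable on ℝ² \ {(0,0)}, with g(λ,0) = λ for all λ, whose zero set is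
exactly G. -/
theorem stmt15 (α β : ℝ) (hαβ : 0 < α ∧ α < β) (G : Set (ℝ × ℝ)) (hG : hypH α β G) :
    ∃ g : ℝ × ℝ → ℝ,
      (∃ K : NNReal, LipschitzWith K g) ∧
      ContDiffOn ℝ (⊤ : ℕ∞) g ({((0 : ℝ), (0 : ℝ))}ᶜ) ∧
      (∀ l : ℝ, g (l, 0) = l) ∧
      (∀ p : ℝ × ℝ, g p = 0 ↔ p ∈ G) := by
  have ha := hαβ.1
  have h0 := hG.zero_mem
  obtain ⟨hsub, hcl, -, -, -, hdisj⟩ := hG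
  have hoff : IsOpen {p : ℝ × ℝ | p.2 ≠ 0} := isOpen_ne_fun continuous_snd continuous_const
  have hGo : IsOpen Gᶜ := hcl.isOpen_compl
  obtain ⟨u, huc, ⟨Ku, huK⟩, hu0, hus⟩ := exists_contDiff_lipschitz_support_eq
    (hGo.connectedComponentIn.inter hoff : IsOpen (Hplus G ∩ _))
  obtain ⟨v, hvc, ⟨Kv, hvK⟩, hv0, hvs⟩ := exists_contDiff_lipschitz_support_eq
    ((hGo.diff_connectedComponentIn _).inter hoff : IsOpen ((Gᶜ \ Hplus G) ∩ _))
  obtain ⟨k, ⟨Kk, hkK⟩, hkc, hkl, hks, hkp⟩ := exists_lipschitz_extension_supported_near_axis ha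
  have hu : ∀ p, p ∉ Hplus G ∩ {p : ℝ × ℝ | p.2 ≠ 0} → u p = 0 := fun p hp =>
    not_not.1 (mt (hus p).1 hp)
  have hv : ∀ p, p ∉ (Gᶜ \ Hplus G) ∩ {p : ℝ × ℝ | p.2 ≠ 0} → v p = 0 := fun p hp =>
    not_not.1 (mt (hvs p).1 hp)
  have haxis : ∀ l : ℝ, u (l, 0) - v (l, 0) + k (l, 0) = l := fun l => by
    rw [hu _ (by simp), hv _ (by simp), hkl, sub_zero, zero_add]
  refine ⟨fun p => u p - v p + k p, ⟨_, (huK.sub hvK).add hkK⟩, fun p hp => ?_, haxis,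
    fun p => ⟨fun h => ?_, fun h => ?_⟩⟩
  · exact ((huc.contDiffAt.sub hvc.contDiffAt).add (hkc p hp)).contDiffWithinAt
  · by_contra hp
    obtain ⟨l, x⟩ := p
    rcases eq_or_ne x 0 with rfl | hx
    · obtain rfl : l = 0 := (haxis l).symm.trans h
      exact hp h0
    have hsign := hkp (l, x)
    by_cases hpl : (l, x) ∈ Hplus G
    · have h1 : 0 < u (l, x) := (hu0 _).lt_of_ne' ((hus _).2 ⟨hpl, hx⟩)
      have h2 : v (l, x) = 0 := hv _ fun h => h.1.2 hpl
      have h3 : k (l, x) < 0 := by linarith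
      have h4 := hks _ h3.ne
      have hl : l ≠ 0 := by rintro rfl; simp at h4; exact absurd h4 (abs_nonneg x).not_gt
      have hl' : l < 0 := lt_of_le_of_ne (nonpos_of_mul_nonneg_right hsign h3) hl
      exact (hdisj ▸ ⟨hpl, mem_Hminus_of_abs_snd_lt ha hsub hl' h4⟩ : (l, x) ∈ (∅ : Set (ℝ × ℝ)))
    · have h1 : 0 < v (l, x) := (hv0 _).lt_of_ne' ((hvs _).2 ⟨⟨hp, hpl⟩, hx⟩)
      have h2 : u (l, x) = 0 := hu _ fun h => hpl h.1
      have h3 : 0 < k (l, x) := by linarith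
      have h4 := hks _ h3.ne'
      have hl : l ≠ 0 := by rintro rfl; simp at h4; exact absurd h4 (abs_nonneg x).not_gt
      have hl' : 0 < l := lt_of_le_of_ne (nonneg_of_mul_nonneg_right hsign h3) hl.symm
      exact hpl (mem_Hplus_of_abs_snd_lt ha hsub hl' h4)
  · have h1 : u p = 0 := hu p fun hp => connectedComponentIn_subset _ _ hp.1 h
    have h2 : v p = 0 := hv p fun hp => hp.1.1 h
    have h3 : k p = 0 := by
      by_contra hk
      exact (hks p hk).not_ge (le_abs_snd_of_mem_cone ha (hsub h))
    simp only [h1, h2, h3, sub_zero, add_zero]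
end
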